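/- arXiv:2401.17739 — 3 statements merged into one kernel-verified Lean document; each statement's English description precedes it below -/
import Mathlib

section
/- Let H be a separable complex Hilbert space and L : D(L) ⊆ H → H a densely defined self-adjoint (unbounded) linear operator such that every sequence (f_j) in D(L) with both (‖f_j‖) and (‖L f_j‖) bounded admits a subsequence converging in H. Then the operator iI − L : D(L) → H (where i is the imaginary unit) is bijective, and its inverse R_L(i) = (iI − L)^{-1}, viewed as an operator H → H, is a compact bounded linear operator. -/
open Filter

/-- A set in a metric space is relatively compact if each of its sequences has a subsequence
converging in the ambient space. -/
theorem isCompact_closure_of_forall_exists_subseq_tendsto {X : Type*} [MetricSpace X] {s : Set X}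
    (h : ∀ u : ℕ → X, (∀ n, u n ∈ s) →
      ∃ (a : X) (φ : ℕ → ℕ), StrictMono φ ∧ Tendsto (u ∘ φ) atTop (nhds a)) :
    IsCompact (closure s) := by
  refine IsSeqCompact.isCompact fun v hv => ?_
  have hclose (n : ℕ) : ∃ x ∈ s, dist (v n) x < 1 / ((n : ℝ) + 1) :=
    Metric.mem_closure_iff.1 (hv n) _ Nat.one_div_pos_of_nat
  choose u hus huv using hclose
  obtain ⟨a, φ, hφ, ha⟩ := h u hus
  have hdist : Tendsto (fun n => dist (u n) (v n)) atTop (nhds 0) :=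
    squeeze_zero (fun _ => dist_nonneg) (fun n => by rw [dist_comm]; exact (huv n).le)
      tendsto_one_div_add_atTop_nhds_zero_nat
  refine ⟨a, mem_closure_of_tendsto ha (Eventually.of_forall fun n => hus _), φ, hφ, ?_⟩
  exact (tendsto_iff_of_dist (hdist.comp hφ.tendsto_atTop)).1 ha

namespace LinearPMap

variable {H : Type*} [NormedAddCommGroup H] [InnerProductSpace ℂ H]

theorem IsFormalAdjoint.inner_apply_self_im {L : H →ₗ.[ℂ] H} (h : L.IsFormalAdjoint L)
    (f : L.domain) : (inner ℂ (f : H) (L f)).im = 0 := by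
  rw [← Complex.conj_eq_iff_im, inner_conj_symm]
  exact h f f

theorem IsFormalAdjoint.norm_smul_sub_sq {L : H →ₗ.[ℂ] H} (h : L.IsFormalAdjoint L)
    {c : ℂ} (hre : c.re = 0) (hc : ‖c‖ = 1) (f : L.domain) :
    ‖c • (f : H) - L f‖ ^ 2 = ‖(f : H)‖ ^ 2 + ‖L f‖ ^ 2 := by
  have hcross : (inner ℂ (c • (f : H)) (L f)).re = 0 := by
    rw [inner_smul_left, Complex.mul_re, h.inner_apply_self_im, Complex.conj_re, hre]
    ring
  have := norm_sub_sq (𝕜 := ℂ) (c • (f : H)) (L f)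
  rw [RCLike.re_eq_complex_re, hcross, norm_smul, hc] at this
  linarith

/-- The linear map `c I - L` on the domain of `L`. -/
noncomputable def smulSub (L : H →ₗ.[ℂ] H) (c : ℂ) : L.domain →ₗ[ℂ] H :=
  c • L.domain.subtype - L.toFun

theorem smulSub_apply (L : H →ₗ.[ℂ] H) (c : ℂ) (f : L.domain) :
    L.smulSub c f = c • (f : H) - L f := rfl

variable [CompleteSpace H]

theorem isFormalAdjoint_of_isSelfAdjoint {L : H →ₗ.[ℂ] H} (hL : IsSelfAdjoint L) :
    L.IsFormalAdjoint L := by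
  have h := adjoint_isFormalAdjoint (T := L) hL.dense_domain
  rwa [isSelfAdjoint_def.1 hL] at h

variable {L : H →ₗ.[ℂ] H}

theorem norm_le_norm_smulSub_I (hL : IsSelfAdjoint L) (f : L.domain) :
    ‖(f : H)‖ ≤ ‖L.smulSub Complex.I f‖ := by
  have := (isFormalAdjoint_of_isSelfAdjoint hL).norm_smul_sub_sq Complex.I_re Complex.norm_I f
  rw [smulSub_apply]
  exact le_of_sq_le_sq (by nlinarith [sq_nonneg ‖L f‖]) (norm_nonneg _)

theorem norm_apply_le_norm_smulSub_I (hL : IsSelfAdjoint L) (f : L.domain) :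
    ‖L f‖ ≤ ‖L.smulSub Complex.I f‖ := by
  have := (isFormalAdjoint_of_isSelfAdjoint hL).norm_smul_sub_sq Complex.I_re Complex.norm_I f
  rw [smulSub_apply]
  exact le_of_sq_le_sq (by nlinarith [sq_nonneg ‖(f : H)‖]) (norm_nonneg _)

theorem smulSub_I_injective (hL : IsSelfAdjoint L) : Function.Injective (L.smulSub Complex.I) := by
  refine (injective_iff_map_eq_zero _).2 fun f hf => ?_
  have := norm_le_norm_smulSub_I hL f
  rw [hf, norm_zero] at this
  exact Subtype.ext (norm_le_zero_iff.1 this)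

theorem isClosed_range_smulSub_I (hL : IsSelfAdjoint L) :
    _root_.IsClosed (LinearMap.range (L.smulSub Complex.I) : Set H) := by
  refine IsSeqClosed.isClosed fun u g hu hg => ?_
  choose f hf using hu
  have hcauchy : CauchySeq fun n => (f n : H) := by
    refine Metric.cauchySeq_iff.2 fun ε hε => ?_
    obtain ⟨N, hN⟩ := Metric.cauchySeq_iff.1 hg.cauchySeq ε hε
    refine ⟨N, fun m hm n hn => lt_of_le_of_lt ?_ (hN m hm n hn)⟩
    rw [dist_eq_norm, dist_eq_norm, ← hf m, ← hf n, ← _root_.map_sub]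
    exact norm_le_norm_smulSub_I hL (f m - f n)
  obtain ⟨x, hx⟩ := cauchySeq_tendsto_of_complete hcauchy
  have hLf : Tendsto (fun n => L (f n)) atTop (nhds (Complex.I • x - g)) := by
    refine ((hx.const_smul Complex.I).sub hg).congr fun n => ?_
    rw [← hf n, smulSub_apply]
    abel
  have hmem : (x, Complex.I • x - g) ∈ L.graph :=
    hL.isClosed.mem_of_tendsto (hx.prodMk_nhds hLf)
      (Eventually.of_forall fun n => L.mem_graph (f n))
  obtain ⟨y, hyx, hyL⟩ := L.mem_graph_iff.1 hmem
  refine ⟨y, ?_⟩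
  rw [smulSub_apply, hyL, hyx]
  exact sub_sub_cancel _ _

theorem range_smulSub_I_orthogonal (hL : IsSelfAdjoint L) :
    (LinearMap.range (L.smulSub Complex.I))ᗮ = ⊥ := by
  refine (Submodule.eq_bot_iff _).2 fun y hy => ?_
  have hweak (x : L.domain) : inner ℂ (-Complex.I • y) (x : H) = inner ℂ y (L x) := by
    have := (Submodule.mem_orthogonal' _ _).1 hy _ ⟨x, rfl⟩
    rw [smulSub_apply, inner_sub_right, inner_smul_right] at this
    rw [inner_smul_left, _root_.map_neg, Complex.conj_I, neg_neg]
    exact sub_eq_zero.1 this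
  have hmem : y ∈ L.adjoint.domain := mem_adjoint_domain_of_exists y ⟨_, hweak⟩
  have heq : L.adjoint ⟨y, hmem⟩ = -Complex.I • y := adjoint_apply_eq hL.dense_domain _ hweak
  have hgraph : (y, -Complex.I • y) ∈ L.adjoint.graph := L.adjoint.mem_graph_iff.2 ⟨_, rfl, heq⟩
  rw [isSelfAdjoint_def.1 hL] at hgraph
  obtain ⟨z, hzy, hzL⟩ := L.mem_graph_iff.1 hgraph
  have := (isFormalAdjoint_of_isSelfAdjoint hL).norm_smul_sub_sq (c := -Complex.I)
    (by simp) (by simp) z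
  simp only [hzy, hzL, sub_self, norm_zero] at this
  have : ‖y‖ ^ 2 = 0 := by nlinarith [sq_nonneg ‖y‖, sq_nonneg ‖-Complex.I • y‖]
  exact norm_eq_zero.1 (pow_eq_zero_iff two_ne_zero |>.1 this)

theorem smulSub_I_bijective (hL : IsSelfAdjoint L) : Function.Bijective (L.smulSub Complex.I) := by
  refine ⟨smulSub_I_injective hL, LinearMap.range_eq_top.1 ?_⟩
  rw [← (isClosed_range_smulSub_I hL).submodule_topologicalClosure_eq]
  exact (Submodule.topologicalClosure_eq_top_iff).2 (range_smulSub_I_orthogonal hL)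

/-- The resolvent `(i I - L)⁻¹` of a self-adjoint operator `L`. -/
noncomputable def resolventI (hL : IsSelfAdjoint L) : H →L[ℂ] H :=
  (L.domain.subtype ∘ₗ
    (LinearEquiv.ofBijective _ (smulSub_I_bijective hL)).symm.toLinearMap).mkContinuous 1
    fun g => by
      have := norm_le_norm_smulSub_I hL
        ((LinearEquiv.ofBijective _ (smulSub_I_bijective hL)).symm g)
      rwa [← LinearEquiv.ofBijective_apply (hf := smulSub_I_bijective hL),
        LinearEquiv.apply_symm_apply, ← one_mul ‖g‖] at this

theorem resolventI_smulSub (hL : IsSelfAdjoint L) (f : L.domain) :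
    resolventI hL (L.smulSub Complex.I f) = f :=
  congrArg Subtype.val
    ((LinearEquiv.ofBijective _ (smulSub_I_bijective hL)).symm_apply_apply f)

end LinearPMap

/-- Let `H` be a separable complex Hilbert space and `L` a densely defined
self-adjoint unbounded operator on `H` whose domain with the graph norm is compactly embedded
in `H`. Then `i I − L : D(L) → H` is bijective and its inverse `R_L(i) = (i I − L)⁻¹`, viewed
as an operator `H → H`, is a compact bounded linear operator. -/
theorem stmt8 {H : Type*} [NormedAddCommGroup H] [InnerProductSpace ℂ H] [CompleteSpace H]
    [TopologicalSpace.SeparableSpace H]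
    (L : H →ₗ.[ℂ] H) (hdense : Dense (L.domain : Set H)) (hsa : IsSelfAdjoint L)
    (hcompact : ∀ f : ℕ → L.domain,
      (∃ C : ℝ, ∀ j, ‖(f j : H)‖ ≤ C) → (∃ C : ℝ, ∀ j, ‖L (f j)‖ ≤ C) →
      ∃ (g : H) (φ : ℕ → ℕ), StrictMono φ ∧
        Tendsto (fun j => ((f (φ j) : H))) atTop (nhds g)) :
    Function.Bijective (fun f : L.domain => Complex.I • (f : H) - L f) ∧
      ∃ R : H →L[ℂ] H, IsCompactOperator (⇑R) ∧
        (∀ f : L.domain, R (Complex.I • (f : H) - L f) = (f : H)) ∧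
        (∀ g : H, ∃ hg : R g ∈ L.domain, Complex.I • (R g) - L ⟨R g, hg⟩ = g) := by
  have hbij := LinearPMap.smulSub_I_bijective hsa
  refine ⟨hbij, LinearPMap.resolventI hsa, ?_, LinearPMap.resolventI_smulSub hsa, fun g => ?_⟩
  · refine (isCompactOperator_iff_isCompact_closure_image_closedBall
      (LinearPMap.resolventI hsa : H →ₗ[ℂ] H) one_pos).2 ?_
    refine isCompact_closure_of_forall_exists_subseq_tendsto fun u hu => ?_
    have hpre (n : ℕ) : ∃ f : L.domain, (f : H) = u n ∧ ‖L.smulSub Complex.I f‖ ≤ 1 := by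
      obtain ⟨g, hg, hgu⟩ := hu n
      obtain ⟨f, rfl⟩ := hbij.surjective g
      exact ⟨f, (LinearPMap.resolventI_smulSub hsa f).symm.trans hgu,
        mem_closedBall_zero_iff.1 hg⟩
    choose f hfu hf using hpre
    obtain ⟨a, φ, hφ, ha⟩ := hcompact f
      ⟨1, fun j => (LinearPMap.norm_le_norm_smulSub_I hsa _).trans (hf j)⟩
      ⟨1, fun j => (LinearPMap.norm_apply_le_norm_smulSub_I hsa _).trans (hf j)⟩
    exact ⟨a, φ, hφ, ha.congr fun j => hfu (φ j)⟩
  · obtain ⟨f, rfl⟩ := hbij.surjective g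
    simp only [LinearPMap.resolventI_smulSub hsa f]
    exact ⟨f.2, rfl⟩
end

section
/- With the diagonal operator L determined by an orthonormal basis {φ_k} of H and real eigenvalues λ_k with |λ_1| ≤ |λ_2| ≤ ⋯ and |λ_k| → ∞: let H' be a complex Hilbert space and A : H → H' a bounded linear operator with A* g ∈ D(L) for every g ∈ H', so that L A* : H' → H is a bounded operator. Then for every n ≥ 1 with λ_{n+1} ≠ 0, the operator norm satisfies ‖A − A ∘ P_n‖_{H→H'} ≤ |λ_{n+1}|^{-1} ‖L A*‖_{H'→H}. -/
open scoped InnerProductSpace ComplexConjugate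

noncomputable section

variable {H : Type*} [NormedAddCommGroup H] [InnerProductSpace ℂ H] [CompleteSpace H]

/-- The domain `D(L)` of the diagonal operator determined by the orthonormal basis `b`
and the real eigenvalues `lam`: those `f` with `Σ_k λ_k² |⟨φ_k, f⟩|² < ∞`. -/
def Ldom (b : HilbertBasis ℕ ℂ H) (lam : ℕ → ℝ) : Set H :=
  {f | Summable fun k => (lam k) ^ 2 * ‖⟪(b k : H), f⟫_ℂ‖ ^ 2}

/-- The diagonal operator `L f = Σ_k λ_k ⟨φ_k, f⟩ φ_k`. -/
def Lop (b : HilbertBasis ℕ ℂ H) (lam : ℕ → ℝ) (f : H) : H :=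
  ∑' k, ((lam k : ℂ) * ⟪(b k : H), f⟫_ℂ) • (b k : H)

/-- The orthogonal projection `P_n` onto the span of the first `n` basis vectors,
as a continuous linear map. -/
def PprojL (b : HilbertBasis ℕ ℂ H) (n : ℕ) : H →L[ℂ] H :=
  ∑ k ∈ Finset.range n, (innerSL ℂ (b k : H)).smulRight (b k : H)

theorem hasSum_norm_inner_sq (b : HilbertBasis ℕ ℂ H) (f : H) :
    HasSum (fun k => ‖⟪(b k : H), f⟫_ℂ‖ ^ 2) (‖f‖ ^ 2) := by
  have h := lp.hasSum_norm (p := 2) (by norm_num) (b.repr f)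
  simpa [b.repr_apply_apply] using h

theorem inner_Lop (b : HilbertBasis ℕ ℂ H) {lam : ℕ → ℝ} {f : H} (hf : f ∈ Ldom b lam) (k : ℕ) :
    ⟪(b k : H), Lop b lam f⟫_ℂ = lam k * ⟪(b k : H), f⟫_ℂ := by
  have hmem : Memℓp (fun k => (lam k : ℂ) * ⟪(b k : H), f⟫_ℂ) 2 := by
    refine memℓp_gen ?_
    simpa [mul_pow, Ldom] using hf
  have hL : Lop b lam f = b.repr.symm ⟨_, hmem⟩ := (b.hasSum_repr_symm ⟨_, hmem⟩).tsum_eq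
  rw [hL, ← b.repr_apply_apply, LinearIsometryEquiv.apply_symm_apply]

theorem inner_PprojL (b : HilbertBasis ℕ ℂ H) (n : ℕ) (f : H) (k : ℕ) :
    ⟪(b k : H), PprojL b n f⟫_ℂ = if k < n then ⟪(b k : H), f⟫_ℂ else 0 := by
  simp [PprojL, orthonormal_iff_ite.mp b.orthonormal k]

theorem inner_PprojL_left (b : HilbertBasis ℕ ℂ H) (n : ℕ) (x y : H) :
    ⟪PprojL b n x, y⟫_ℂ = ⟪x, PprojL b n y⟫_ℂ := by
  simp [PprojL, mul_comm]

theorem adjoint_PprojL (b : HilbertBasis ℕ ℂ H) (n : ℕ) :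
    ContinuousLinearMap.adjoint (PprojL b n) = PprojL b n :=
  ((ContinuousLinearMap.eq_adjoint_iff _ _).mpr (inner_PprojL_left b n)).symm

/-- The tail estimate `|λ n| ‖f - P_n f‖ ≤ ‖L f‖` for `f ∈ D(L)`. -/
theorem abs_mul_norm_sub_PprojL_le (b : HilbertBasis ℕ ℂ H) {lam : ℕ → ℝ}
    (hmono : Monotone fun k => |lam k|) {f : H} (hf : f ∈ Ldom b lam) (n : ℕ) :
    |lam n| * ‖f - PprojL b n f‖ ≤ ‖Lop b lam f‖ := by
  refine le_of_sq_le_sq ?_ (norm_nonneg _)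
  rw [mul_pow]
  refine hasSum_le (fun k => ?_) ((hasSum_norm_inner_sq b (f - PprojL b n f)).mul_left _)
    (hasSum_norm_inner_sq b (Lop b lam f))
  rw [inner_Lop b hf, inner_sub_right, inner_PprojL, norm_mul, mul_pow, Complex.norm_real,
    Real.norm_eq_abs]
  split_ifs with hk
  · rw [sub_self, norm_zero, zero_pow two_ne_zero, mul_zero]
    positivity
  · rw [sub_zero]
    have h : |lam n| ≤ |lam k| := hmono (not_lt.mp hk)
    gcongr

/-- With `A : H → H'` bounded, `A* g ∈ D(L)` for all `g`, and
`T = L A* : H' → H` the resulting bounded operator: for every `n ≥ 1` with `λ n ≠ 0`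
(`0`-indexed, so `λ n` is the paper's `λ_{n+1}` and `P n` projects onto the first `n`
basis vectors), one has `‖A − A P_n‖ ≤ |λ n|⁻¹ ‖L A*‖`. -/
theorem stmt10 {H' : Type*} [NormedAddCommGroup H'] [InnerProductSpace ℂ H'] [CompleteSpace H']
    (b : HilbertBasis ℕ ℂ H) (lam : ℕ → ℝ)
    (hmono : Monotone fun k => |lam k|)
    (htend : Filter.Tendsto (fun k => |lam k|) Filter.atTop Filter.atTop)
    (A : H →L[ℂ] H')
    (hdom : ∀ g : H', ContinuousLinearMap.adjoint A g ∈ Ldom b lam)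
    (T : H' →L[ℂ] H)
    (hT : ∀ g : H', T g = Lop b lam (ContinuousLinearMap.adjoint A g))
    (n : ℕ) (hn : 1 ≤ n) (hlam : lam n ≠ 0) :
    ‖A - A.comp (PprojL b n)‖ ≤ |lam n|⁻¹ * ‖T‖ := by
  rw [← LinearIsometryEquiv.norm_map ContinuousLinearMap.adjoint, map_sub,
    ContinuousLinearMap.adjoint_comp, adjoint_PprojL]
  refine ContinuousLinearMap.opNorm_le_bound _ (by positivity) fun g => ?_
  rw [mul_assoc, le_inv_mul_iff₀ (abs_pos.mpr hlam)]
  refine (abs_mul_norm_sub_PprojL_le b hmono (hdom g) n).trans ?_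
  rw [← hT]
  exact T.le_opNorm g

end
end

section
/- With the diagonal operator L determined by an orthonormal basis {φ_k} of H and real eigenvalues λ_k with |λ_1| ≤ |λ_2| ≤ ⋯ and |λ_k| → ∞: let H' be a complex Hilbert space and A : H → H' a bounded linear operator with A* g ∈ D(L) for every g ∈ H', so that L A* : H' → H is bounded. Let (P̃_n)_{n≥1} be a sequence of orthogonal projections on H with Range(P̃_n) ⊆ D(L) and P̃_n f → f for every f ∈ H (strong convergence to the identity). Then each A ∘ L ∘ P̃_n is a bounded operator H → H' and ‖A ∘ L ∘ P̃_n‖_{H→H'} → ‖L A*‖_{H'→H} as n → ∞. -/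
open scoped InnerProductSpace ComplexConjugate

noncomputable section

variable {H : Type*} [NormedAddCommGroup H] [InnerProductSpace ℂ H] [CompleteSpace H]

/-- On `D(L)` the series defining `L` converges. -/
theorem hasSum_Lop {E : Type*} [NormedAddCommGroup E] [InnerProductSpace ℂ E]
    (b : HilbertBasis ℕ ℂ E) (lam : ℕ → ℝ) {f : E} (hf : f ∈ Ldom b lam) :
    HasSum (fun k => ((lam k : ℂ) * ⟪(b k : E), f⟫_ℂ) • (b k : E)) (Lop b lam f) := by
  have hmem : Memℓp (fun k => (lam k : ℂ) * ⟪(b k : E), f⟫_ℂ) 2 := by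
    apply memℓp_gen
    simpa [mul_pow] using (show Summable _ from hf)
  exact (b.hasSum_repr_symm ⟨_, hmem⟩).summable.hasSum

/-- The diagonal operator with real eigenvalues is symmetric on its domain. -/
theorem inner_Lop_right {E : Type*} [NormedAddCommGroup E] [InnerProductSpace ℂ E]
    (b : HilbertBasis ℕ ℂ E) (lam : ℕ → ℝ) {f g : E} (hf : f ∈ Ldom b lam) (hg : g ∈ Ldom b lam) :
    ⟪f, Lop b lam g⟫_ℂ = ⟪Lop b lam f, g⟫_ℂ := by
  have hright := (hasSum_Lop b lam hg).mapL (innerSL ℂ f)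
  have hleft := ((hasSum_Lop b lam hf).mapL (innerSL ℂ g)).star
  simp only [innerSL_apply_apply, RCLike.star_def, inner_conj_symm] at hright hleft
  refine hright.unique (hleft.congr_fun fun k => ?_)
  simp only [inner_smul_left, inner_smul_right, map_mul, Complex.conj_ofReal, inner_conj_symm]
  ring

/-- If `P n` are contractions converging strongly to the identity, then `‖B ∘ P n‖ → ‖B‖`. -/
theorem tendsto_norm_comp_of_tendsto_id {E F : Type*} [NormedAddCommGroup E] [NormedSpace ℂ E]
    [NormedAddCommGroup F] [NormedSpace ℂ F] (B : E →L[ℂ] F) (P : ℕ → E →L[ℂ] E)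
    (hP : ∀ n, ‖P n‖ ≤ 1)
    (hstrong : ∀ f : E, Filter.Tendsto (fun n => P n f) Filter.atTop (nhds f)) :
    Filter.Tendsto (fun n => ‖B ∘L P n‖) Filter.atTop (nhds ‖B‖) := by
  have hle (n : ℕ) : ‖B ∘L P n‖ ≤ ‖B‖ :=
    (B.opNorm_comp_le (P n)).trans (mul_le_of_le_one_right (norm_nonneg B) (hP n))
  refine tendsto_order.2 ⟨fun c hc => ?_, fun c hc => .of_forall fun n => (hle n).trans_lt hc⟩
  obtain ⟨f, hf, hcf⟩ := B.exists_lt_apply_of_lt_opNorm hc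
  have hlim : Filter.Tendsto (fun n => ‖B (P n f)‖) Filter.atTop (nhds ‖B f‖) :=
    ((B.continuous.tendsto f).comp (hstrong f)).norm
  filter_upwards [hlim.eventually_const_lt hcf] with n hn
  exact hn.trans_le ((B ∘L P n).unit_le_opNorm f hf.le)

/-- With `A : H → H'` bounded, `A* g ∈ D(L)` for all `g`, and
`T = L A* : H' → H` bounded: if `(P̃_n)` is a sequence of orthogonal projections on `H`
(idempotent and self-adjoint) with ranges contained in `D(L)` and converging strongly to
the identity, then each `A ∘ L ∘ P̃_n` is a bounded operator `H → H'` and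
`‖A L P̃_n‖ → ‖L A*‖` as `n → ∞`. -/
theorem stmt14 {H' : Type*} [NormedAddCommGroup H'] [InnerProductSpace ℂ H'] [CompleteSpace H']
    (b : HilbertBasis ℕ ℂ H) (lam : ℕ → ℝ)
    (hmono : Monotone fun k => |lam k|)
    (htend : Filter.Tendsto (fun k => |lam k|) Filter.atTop Filter.atTop)
    (A : H →L[ℂ] H')
    (hdom : ∀ g : H', ContinuousLinearMap.adjoint A g ∈ Ldom b lam)
    (T : H' →L[ℂ] H)
    (hT : ∀ g : H', T g = Lop b lam (ContinuousLinearMap.adjoint A g))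
    (P : ℕ → H →L[ℂ] H)
    (hidem : ∀ n, IsIdempotentElem (P n))
    (hsa : ∀ n, IsSelfAdjoint (P n))
    (hrange : ∀ n, ∀ f : H, P n f ∈ Ldom b lam)
    (hstrong : ∀ f : H, Filter.Tendsto (fun n => P n f) Filter.atTop (nhds f)) :
    ∃ S : ℕ → (H →L[ℂ] H'),
      (∀ n, ∀ f : H, S n f = A (Lop b lam (P n f))) ∧
      Filter.Tendsto (fun n => ‖S n‖) Filter.atTop (nhds ‖T‖) := by
  refine ⟨fun n => ContinuousLinearMap.adjoint T ∘L P n, fun n f => ?_, ?_⟩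
  · refine ext_inner_left ℂ fun g => ?_
    rw [ContinuousLinearMap.comp_apply, ContinuousLinearMap.adjoint_inner_right, hT,
      ← inner_Lop_right b lam (hdom g) (hrange n f), ContinuousLinearMap.adjoint_inner_left]
  · rw [← ContinuousLinearMap.adjoint.norm_map T]
    exact tendsto_norm_comp_of_tendsto_id _ P
      (fun n => IsStarProjection.norm_le _ ⟨hidem n, hsa n⟩) hstrong

end
end
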